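/- Suppose ξ is a point process on ℝ, almost surely infinite in both directions, such that for every compact interval I ⊂ ℝ there exist positive constants C, c (depending on I) with P(ξ(I) ≥ t) ≤ C e^{−ct} for all t ≥ 0. Suppose ξ_1, ξ_2, ... are point processes on ℝ, almost surely infinite in both directions, such that ξ_ℓ(I) has finite k-th moment for all compact intervals I and all ℓ, k ≥ 1. If ξ_ℓ converges in correlation to ξ, then ξ_ℓ converges in distribution to ξ. -/

import Mathlib

open MeasureTheory Filter Topology Bornology

noncomputable def xLabel (μ : MeasureTheory.Measure ℝ) (n : ℤ) : ℝ :=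
  if 0 < n then sInf {x : ℝ | 0 < x ∧ (n.toNat : ENNReal) ≤ μ (Set.Ioc 0 x)}
  else sSup {x : ℝ | x ≤ 0 ∧ ((1 - n).toNat : ENNReal) ≤ μ (Set.Ioc x 0)}

def IsPointMeasure (μ : MeasureTheory.Measure ℝ) : Prop :=
  ∀ B : Set ℝ, MeasurableSet B → IsBounded B → ∃ m : ℕ, μ B = m

def InfiniteBothDirections (μ : MeasureTheory.Measure ℝ) : Prop :=
  μ (Set.Iio 0) = ⊤ ∧ μ (Set.Ioi 0) = ⊤

open Classical in
/-- The `k`-point correlation sum `C_k(μ, f)`: the sum over tuples of pairwise distinct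
indices `(n_1,...,n_k) ∈ ℤ^k` of `f(x_{n_1}(μ),...,x_{n_k}(μ))`. -/
noncomputable def corrSumM (μ : MeasureTheory.Measure ℝ) (k : ℕ) (f : (Fin k → ℝ) → ℝ) : ℝ :=
  ∑' m : Fin k → ℤ, if Function.Injective m then f (fun i => xLabel μ (m i)) else 0

/-- Convergence in correlation of point processes. -/
def ConvInCorr {Ω : Type*} [MeasurableSpace Ω] (P : MeasureTheory.Measure Ω)
    (ξs : ℕ → Ω → MeasureTheory.Measure ℝ) (ξ : Ω → MeasureTheory.Measure ℝ) : Prop :=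
  ∀ k : ℕ, 1 ≤ k → ∀ f : (Fin k → ℝ) → ℝ, Continuous f → HasCompactSupport f →
    Tendsto (fun ℓ => ∫ ω, corrSumM (ξs ℓ ω) k f ∂P) atTop
      (𝓝 (∫ ω, corrSumM (ξ ω) k f ∂P))

/-- Convergence in distribution of point processes, in the sense of linear statistics. -/
def ConvInDist {Ω : Type*} [MeasurableSpace Ω] (P : MeasureTheory.Measure Ω)
    (ξs : ℕ → Ω → MeasureTheory.Measure ℝ) (ξ : Ω → MeasureTheory.Measure ℝ) : Prop :=
  ∀ f : ℝ → ℝ, Continuous f → HasCompactSupport f →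
    ∀ g : BoundedContinuousFunction ℝ ℝ,
    Tendsto (fun ℓ => ∫ ω, g (∫ x, f x ∂(ξs ℓ ω)) ∂P) atTop
      (𝓝 (∫ ω, g (∫ x, f x ∂(ξ ω)) ∂P))

theorem norm_exp_mul_sub_sum_le {z : ℂ} (hz : z.re = 0) (hz1 : ‖z‖ ≤ 1) (n : ℕ) :
    ∀ x : ℝ, 0 ≤ x → ‖Complex.exp (z * x) - ∑ j ∈ Finset.range n, (z * x) ^ j / (j.factorial : ℂ)‖
      ≤ x ^ n / n.factorial := by
  induction n with
  | zero =>
    intro x _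
    simp [Complex.norm_exp, hz]
  | succ n ih =>
    intro x hx
    have hB : ∀ y : ℝ, HasDerivAt (fun y : ℝ => y ^ (n + 1) / ((n + 1).factorial : ℝ))
        (y ^ n / (n.factorial : ℝ)) y := by
      intro y
      have h := (hasDerivAt_pow (n + 1) y).div_const ((n + 1).factorial : ℝ)
      convert! h using 1
      rw [Nat.factorial_succ]
      have : (n.factorial : ℝ) ≠ 0 := by positivity
      push_cast
      field_simp
    have hf : ∀ y : ℝ, HasDerivAt (fun y : ℝ => Complex.exp (z * y) -
        ∑ j ∈ Finset.range (n + 1), (z * y) ^ j / (j.factorial : ℂ))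
        (z * (Complex.exp (z * y) - ∑ j ∈ Finset.range n, (z * y) ^ j / (j.factorial : ℂ))) y := by
      intro y
      have h0 : HasDerivAt (fun y : ℝ => z * (y : ℂ)) z y := by
        simpa using (Complex.ofRealCLM.hasDerivAt (x := y)).const_mul z
      have h1 := h0.cexp
      have h2 : HasDerivAt (fun y : ℝ => ∑ j ∈ Finset.range (n + 1),
          (z * (y : ℂ)) ^ j / (j.factorial : ℂ))
          (∑ j ∈ Finset.range (n + 1), ((j : ℂ) * (z * (y : ℂ)) ^ (j - 1) * z) / (j.factorial : ℂ)) y :=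
        HasDerivAt.fun_sum fun j _ => (h0.pow j).div_const _
      convert! h1.sub h2 using 1
      rw [Finset.sum_range_succ', mul_sub, Finset.mul_sum]
      have : ∀ j ∈ Finset.range n, (((j + 1 : ℕ) : ℂ) * (z * (y : ℂ)) ^ (j + 1 - 1) * z) /
          ((j + 1).factorial : ℂ) = z * ((z * (y : ℂ)) ^ j / (j.factorial : ℂ)) := by
        intro j _
        rw [Nat.factorial_succ]
        have h3 : (j.factorial : ℂ) ≠ 0 := by exact_mod_cast j.factorial_ne_zero
        have h4 : ((j : ℂ) + 1) ≠ 0 := by exact_mod_cast j.succ_ne_zero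
        push_cast
        field_simp
      rw [Finset.sum_congr rfl this]
      simp [mul_comm]
    refine image_norm_le_of_norm_deriv_right_le_deriv_boundary (a := 0) (b := x)
      (fun y _ => (hf y).continuousAt.continuousWithinAt) (fun y _ => (hf y).hasDerivWithinAt)
      ?_ hB ?_ (Set.right_mem_Icc.2 hx)
    · simp [Finset.sum_range_succ']
    · intro y hy
      rw [norm_mul]
      calc _ ≤ 1 * _ := mul_le_mul_of_nonneg_right hz1 (norm_nonneg _)
        _ ≤ _ := by rw [one_mul]; exact ih y hy.1

theorem norm_exp_mul_I_sub_sum_le (n : ℕ) (x : ℝ) :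
    ‖Complex.exp (x * Complex.I) - ∑ j ∈ Finset.range n, (x * Complex.I) ^ j / (j.factorial : ℂ)‖
      ≤ |x| ^ n / n.factorial := by
  rcases le_total 0 x with h | h
  · have := norm_exp_mul_sub_sum_le (z := Complex.I) (by simp) (by simp) n x h
    simpa [mul_comm, abs_of_nonneg h] using this
  · have := norm_exp_mul_sub_sum_le (z := -Complex.I) (by simp) (by simp) n (-x) (by linarith)
    simpa [mul_comm, abs_of_nonpos h] using this

section Moments

variable {Ω : Type*} [MeasurableSpace Ω] {P : Measure Ω}

theorem integrable_abs_pow_mul_exp {Y : Ω → ℝ} (hY : AEMeasurable Y P) {s : ℝ} (hs : 0 < s)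
    (hYexp : Integrable (fun ω => Real.exp (s * |Y ω|)) P) (k : ℕ) {h : ℝ} (hh : h ≤ s / 2) :
    Integrable (fun ω => |Y ω| ^ k * Real.exp (h * |Y ω|)) P := by
  refine (hYexp.const_mul (k.factorial / (s / 2) ^ k)).mono' (by fun_prop) (ae_of_all _ fun ω => ?_)
  rw [Real.norm_of_nonneg (by positivity)]
  have h1 := Real.pow_div_factorial_le_exp (x := s / 2 * |Y ω|) (by positivity) k
  have h2 : Real.exp (h * |Y ω|) ≤ Real.exp (s / 2 * |Y ω|) := by
    gcongr
  have h3 : Real.exp (s * |Y ω|) = Real.exp (s / 2 * |Y ω|) * Real.exp (s / 2 * |Y ω|) := by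
    rw [← Real.exp_add]; ring_nf
  have h4 : |Y ω| ^ k = k.factorial / (s / 2) ^ k * ((s / 2 * |Y ω|) ^ k / k.factorial) := by
    have : (k.factorial : ℝ) ≠ 0 := by positivity
    rw [mul_pow]; field_simp
  rw [h3, h4, mul_assoc]
  gcongr

theorem summable_integral_abs_pow {Y : Ω → ℝ} (hY : AEMeasurable Y P) {s : ℝ} (hs : 0 < s)
    (hYexp : Integrable (fun ω => Real.exp (s * |Y ω|)) P) (k : ℕ) {h : ℝ} (hh : |h| ≤ s / 2) :
    Summable (fun n : ℕ => |h| ^ n / n.factorial * ∫ ω, |Y ω| ^ (k + n) ∂P) := by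
  have hXpow : ∀ j : ℕ, Integrable (fun ω => |Y ω| ^ j) P := fun j => by
    simpa using integrable_abs_pow_mul_exp hY hs hYexp j (h := 0) (by positivity)
  refine summable_of_sum_range_le (c := ∫ ω, |Y ω| ^ k * Real.exp (|h| * |Y ω|) ∂P)
    (fun n => by positivity) fun n => ?_
  simp_rw [← integral_const_mul]
  rw [← integral_finsetSum _ fun j _ => (hXpow _).const_mul _]
  refine integral_mono (integrable_finsetSum _ fun j _ => (hXpow _).const_mul _)
    (integrable_abs_pow_mul_exp hY hs hYexp k hh) fun ω => ?_
  have := Real.sum_le_exp_of_nonneg (x := |h| * |Y ω|) (by positivity) n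
  calc _ = |Y ω| ^ k * ∑ j ∈ Finset.range n, (|h| * |Y ω|) ^ j / j.factorial := by
        rw [Finset.mul_sum]
        refine Finset.sum_congr rfl fun j _ => ?_
        rw [mul_pow]; ring
    _ ≤ _ := by gcongr

theorem norm_pow_mul_exp_sub_sum_le (k n : ℕ) (t h x : ℝ) :
    ‖(x : ℂ) ^ k * Complex.exp (((t + h : ℝ) : ℂ) * x * Complex.I) -
      ∑ j ∈ Finset.range n, ((h * Complex.I) ^ j / (j.factorial : ℂ)) *
        ((x : ℂ) ^ (k + j) * Complex.exp (t * x * Complex.I))‖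
      ≤ |h| ^ n / n.factorial * |x| ^ (k + n) := by
  have h1 := norm_exp_mul_I_sub_sum_le n (h * x)
  have h2 : (x : ℂ) ^ k * Complex.exp (((t + h : ℝ) : ℂ) * x * Complex.I) -
      ∑ j ∈ Finset.range n, ((h * Complex.I) ^ j / (j.factorial : ℂ)) *
        ((x : ℂ) ^ (k + j) * Complex.exp (t * x * Complex.I)) =
      (x : ℂ) ^ k * Complex.exp (((t * x : ℝ) : ℂ) * Complex.I) * (Complex.exp (((h * x : ℝ) : ℂ) * Complex.I) -
        ∑ j ∈ Finset.range n, (((h * x : ℝ) : ℂ) * Complex.I) ^ j / (j.factorial : ℂ)) := by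
    rw [mul_sub, Finset.mul_sum]
    congr 1
    · rw [mul_assoc ((x : ℂ) ^ k), ← Complex.exp_add]
      congr 2
      push_cast
      ring
    · refine Finset.sum_congr rfl fun j _ => ?_
      push_cast
      ring
  rw [h2, norm_mul, norm_mul, Complex.norm_exp_ofReal_mul_I, mul_one, norm_pow, Complex.norm_real,
    Real.norm_eq_abs]
  calc _ ≤ |x| ^ k * (|h * x| ^ n / n.factorial) := by gcongr
    _ = _ := by rw [abs_mul, mul_pow]; ring

theorem integrable_pow_mul_cexp {X : Ω → ℝ} (hX : AEMeasurable X P) (k : ℕ)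
    (hXpow : Integrable (fun ω => X ω ^ k) P) (t : ℝ) :
    Integrable (fun ω => (X ω : ℂ) ^ k * Complex.exp (t * X ω * Complex.I)) P := by
  refine hXpow.norm.mono' (by fun_prop) (ae_of_all _ fun ω => ?_)
  rw [norm_mul, ← Complex.ofReal_mul, Complex.norm_exp_ofReal_mul_I, norm_pow, Complex.norm_real,
    mul_one, norm_pow]

theorem norm_integral_pow_mul_exp_sub_le {X : Ω → ℝ} (hX : AEMeasurable X P)
    (hXpow : ∀ k : ℕ, Integrable (fun ω => X ω ^ k) P) {k n : ℕ} (hkn : Even (k + n)) (t h : ℝ) :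
    ‖∫ ω, (X ω : ℂ) ^ k * Complex.exp (((t + h : ℝ) : ℂ) * X ω * Complex.I) ∂P -
      ∑ j ∈ Finset.range n, ((h * Complex.I) ^ j / (j.factorial : ℂ)) *
        ∫ ω, ((X ω : ℂ) ^ (k + j) * Complex.exp (t * X ω * Complex.I)) ∂P‖
      ≤ |h| ^ n / n.factorial * ∫ ω, X ω ^ (k + n) ∂P := by
  have hi := fun k => integrable_pow_mul_cexp hX k (hXpow k)
  simp_rw [← integral_const_mul]
  rw [← integral_finsetSum _ fun j _ => (hi _ _).const_mul _,
    ← integral_sub (hi _ _) (integrable_finsetSum _ fun j _ => (hi _ _).const_mul _)]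
  refine norm_integral_le_of_norm_le ((hXpow _).const_mul _) (ae_of_all _ fun ω => ?_)
  simpa [hkn.pow_abs] using norm_pow_mul_exp_sub_sum_le k n t h (X ω)

theorem tendsto_integral_pow_mul_exp [IsProbabilityMeasure P] {X : ℕ → Ω → ℝ} {Y : Ω → ℝ}
    (hX : ∀ ℓ, AEMeasurable (X ℓ) P) (hY : AEMeasurable Y P)
    (hXint : ∀ ℓ, ∀ k : ℕ, Integrable (fun ω => X ℓ ω ^ k) P)
    {s : ℝ} (hs : 0 < s) (hYexp : Integrable (fun ω => Real.exp (s * |Y ω|)) P)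
    (hmom : ∀ k : ℕ, Tendsto (fun ℓ => ∫ ω, X ℓ ω ^ k ∂P) atTop (𝓝 (∫ ω, Y ω ^ k ∂P)))
    (m : ℕ) : ∀ t : ℝ, |t| ≤ m * (s / 2) → ∀ k : ℕ,
    Tendsto (fun ℓ => ∫ ω, (X ℓ ω : ℂ) ^ k * Complex.exp (t * X ℓ ω * Complex.I) ∂P) atTop
      (𝓝 (∫ ω, (Y ω : ℂ) ^ k * Complex.exp (t * Y ω * Complex.I) ∂P)) := by
  have hYint : ∀ j : ℕ, Integrable (fun ω => Y ω ^ j) P := fun j => by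
    have h1 : Integrable (fun ω => |Y ω| ^ j) P := by
      simpa using integrable_abs_pow_mul_exp hY hs hYexp j (h := 0) (by positivity)
    exact h1.mono' (by fun_prop) (ae_of_all _ fun ω => by simp)
  induction m with
  | zero =>
    intro t ht k
    have : t = 0 := by simpa using ht
    subst this
    have := (Complex.continuous_ofReal.tendsto _).comp (hmom k)
    simpa [← Complex.ofReal_pow, integral_complex_ofReal, Function.comp_def] using this
  | succ m ih =>
    intro t ht k
    have hm : (0 : ℝ) < m + 1 := by positivity
    push_cast at ht
    set h : ℝ := t / (m + 1) with hh
    set t₀ : ℝ := t * m / (m + 1) with ht₀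
    have hsum : t = t₀ + h := by rw [hh, ht₀]; field_simp
    have hh' : |h| ≤ s / 2 := by
      rw [hh, abs_div, abs_of_pos hm, div_le_iff₀ hm]; linarith
    have ht₀' : |t₀| ≤ m * (s / 2) := by
      rw [ht₀, abs_div, abs_of_pos hm, div_le_iff₀ hm, abs_mul, Nat.abs_cast]
      nlinarith [mul_le_mul_of_nonneg_right ht (Nat.cast_nonneg (α := ℝ) m)]
    have htend := (summable_integral_abs_pow hY hs hYexp k hh').tendsto_atTop_zero
    rw [Metric.tendsto_nhds]
    intro ε hε
    obtain ⟨N, hN⟩ := eventually_atTop.1 (htend.eventually (gt_mem_nhds (by positivity : 0 < ε / 3)))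
    set n : ℕ := k + 2 * N with hn
    have hkn : Even (k + n) := ⟨k + N, by omega⟩
    have hbY : |h| ^ n / n.factorial * ∫ ω, Y ω ^ (k + n) ∂P < ε / 3 := by
      simpa [hkn.pow_abs] using hN n (by omega)
    have hbX := ((hmom (k + n)).const_mul (|h| ^ n / n.factorial)).eventually (gt_mem_nhds hbY)
    have hA := tendsto_finsetSum (Finset.range n) fun j _ =>
      (ih t₀ ht₀' (k + j)).const_mul ((h * Complex.I) ^ j / (j.factorial : ℂ))
    filter_upwards [hbX, Metric.tendsto_nhds.1 hA _ (by positivity : 0 < ε / 3)] with ℓ h1 h2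
    have h3 := norm_integral_pow_mul_exp_sub_le (hX ℓ) (hXint ℓ) hkn t₀ h
    have h4 := norm_integral_pow_mul_exp_sub_le hY hYint hkn t₀ h
    rw [← hsum, ← dist_eq_norm] at h3 h4
    rw [dist_comm] at h4
    refine (dist_triangle _ _ _).trans_lt
      ((add_lt_add_of_le_of_lt ((dist_triangle _ _ _).trans (add_le_add h3 h2.le))
        (h4.trans_lt hbY)).trans ?_)
    linarith

theorem tendsto_integral_boundedContinuous_of_tendsto_moments [IsProbabilityMeasure P]
    {X : ℕ → Ω → ℝ} {Y : Ω → ℝ}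
    (hX : ∀ ℓ, AEMeasurable (X ℓ) P) (hY : AEMeasurable Y P)
    (hXint : ∀ ℓ, ∀ k : ℕ, Integrable (fun ω => X ℓ ω ^ k) P)
    {s : ℝ} (hs : 0 < s) (hYexp : Integrable (fun ω => Real.exp (s * |Y ω|)) P)
    (hmom : ∀ k : ℕ, Tendsto (fun ℓ => ∫ ω, X ℓ ω ^ k ∂P) atTop (𝓝 (∫ ω, Y ω ^ k ∂P)))
    (g : BoundedContinuousFunction ℝ ℝ) :
    Tendsto (fun ℓ => ∫ ω, g (X ℓ ω) ∂P) atTop (𝓝 (∫ ω, g (Y ω) ∂P)) := by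
  let μ : ℕ → ProbabilityMeasure ℝ := fun ℓ => ⟨P.map (X ℓ), Measure.isProbabilityMeasure_map (hX ℓ)⟩
  let ν : ProbabilityMeasure ℝ := ⟨P.map Y, Measure.isProbabilityMeasure_map hY⟩
  have h : Tendsto μ atTop (𝓝 ν) := by
    refine ProbabilityMeasure.tendsto_of_tendsto_charFun fun t => ?_
    obtain ⟨m, hm⟩ := exists_nat_ge (|t| / (s / 2))
    rw [div_le_iff₀ (by positivity)] at hm
    have := tendsto_integral_pow_mul_exp hX hY hXint hs hYexp hmom m t hm 0
    simp only [charFun_apply_real]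
    convert! this using 1
    · ext ℓ
      change ∫ x, _ ∂(P.map (X ℓ)) = _
      rw [integral_map (hX ℓ) (by fun_prop)]
      simp
    · change 𝓝 (∫ x, _ ∂(P.map Y)) = _
      rw [integral_map hY (by fun_prop)]
      simp
  have h2 := (ProbabilityMeasure.tendsto_iff_forall_integral_tendsto.1 h) g
  convert! h2 using 1
  · ext ℓ
    change _ = ∫ x, _ ∂(P.map (X ℓ))
    rw [integral_map (hX ℓ) (by fun_prop)]
  · change _ = 𝓝 (∫ x, _ ∂(P.map Y))
    rw [integral_map hY (by fun_prop)]

end Moments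

theorem IsPointMeasure.measure_ne_top {μ : Measure ℝ} (hμ : IsPointMeasure μ) {B : Set ℝ}
    (hB : MeasurableSet B) (hb : IsBounded B) : μ B ≠ ⊤ := by
  obtain ⟨m, hm⟩ := hμ B hB hb
  simp [hm]

theorem IsPointMeasure.isLocallyFiniteMeasure {μ : Measure ℝ} (hμ : IsPointMeasure μ) :
    IsLocallyFiniteMeasure μ :=
  ⟨fun x => ⟨Metric.ball x 1, Metric.ball_mem_nhds x one_pos,
    (hμ.measure_ne_top measurableSet_ball Metric.isBounded_ball).lt_top⟩⟩

theorem IsPointMeasure.le_measure_Ioc_of_forall_gt {μ : Measure ℝ} (hμ : IsPointMeasure μ)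
    {a : ℝ} {c : ENNReal} (h : ∀ b, a < b → c ≤ μ (Set.Ioc 0 b)) : c ≤ μ (Set.Ioc 0 a) := by
  have h1 := tendsto_measure_biInter_gt (μ := μ) (s := fun r => Set.Ioc 0 r) (a := a)
    (fun r _ => measurableSet_Ioc.nullMeasurableSet)
    (fun i j _ hij => Set.Ioc_subset_Ioc_right hij)
    ⟨a + 1, by simp, hμ.measure_ne_top measurableSet_Ioc (Metric.isBounded_Ioc _ _)⟩
  have h2 : (⋂ r > a, Set.Ioc (0 : ℝ) r) = Set.Ioc 0 a := by
    ext x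
    simp only [Set.mem_iInter, Set.mem_Ioc]
    refine ⟨fun hx => ⟨(hx (a + 1) (by simp)).1, le_of_forall_gt_imp_ge_of_dense fun r hr => (hx r hr).2⟩,
      fun hx r hr => ⟨hx.1, hx.2.trans (le_of_lt hr)⟩⟩
  rw [h2] at h1
  exact ge_of_tendsto h1 (eventually_nhdsWithin_of_forall fun b hb => h b hb)

theorem IsPointMeasure.le_measure_Icc_of_forall_lt {μ : Measure ℝ} (hμ : IsPointMeasure μ)
    {a : ℝ} {c : ENNReal} (h : ∀ b, b < a → c ≤ μ (Set.Ioc b 0)) : c ≤ μ (Set.Icc a 0) := by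
  have h1 := tendsto_measure_biInter_gt (μ := μ) (s := fun r => Set.Ioc (-r) 0) (a := -a)
    (fun r _ => measurableSet_Ioc.nullMeasurableSet)
    (fun i j _ hij => Set.Ioc_subset_Ioc_left (neg_le_neg hij))
    ⟨-a + 1, by simp, hμ.measure_ne_top measurableSet_Ioc (Metric.isBounded_Ioc _ _)⟩
  have h2 : (⋂ r > -a, Set.Ioc (-r) (0 : ℝ)) = Set.Icc a 0 := by
    ext x
    simp only [Set.mem_iInter, Set.mem_Ioc, Set.mem_Icc]
    refine ⟨fun hx => ⟨le_of_forall_lt fun r hr => ?_, (hx (-a + 1) (by simp)).2⟩,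
      fun hx r hr => ⟨by linarith [hx.1], hx.2⟩⟩
    have := (hx (-r) (by simpa using hr)).1
    simpa using this
  rw [h2] at h1
  refine ge_of_tendsto h1 (eventually_nhdsWithin_of_forall fun b hb => h (-b) ?_)
  have : -a < b := hb
  linarith

theorem exists_le_measure_Ioc_right {μ : Measure ℝ} (hμ : μ (Set.Ioi 0) = ⊤) (N : ℕ) :
    ∃ b : ℝ, 0 < b ∧ (N : ENNReal) ≤ μ (Set.Ioc 0 b) := by
  have h1 := tendsto_measure_iUnion_atTop (μ := μ) (s := fun k : ℕ => Set.Ioc (0 : ℝ) (k + 1))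
    (fun i j hij => Set.Ioc_subset_Ioc_right (by gcongr))
  have h2 : (⋃ k : ℕ, Set.Ioc (0 : ℝ) (k + 1)) = Set.Ioi 0 := by
    ext x
    simp only [Set.mem_iUnion, Set.mem_Ioc, Set.mem_Ioi]
    refine ⟨fun ⟨k, hk⟩ => hk.1, fun hx => ?_⟩
    obtain ⟨k, hk⟩ := exists_nat_ge x
    exact ⟨k, hx, by linarith⟩
  rw [h2, hμ] at h1
  obtain ⟨k, hk⟩ := (h1.eventually (lt_mem_nhds (ENNReal.natCast_lt_top N))).exists
  exact ⟨k + 1, by positivity, le_of_lt hk⟩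

theorem exists_le_measure_Ioc_left {μ : Measure ℝ} (hμ : μ (Set.Iio 0) = ⊤) (N : ℕ) :
    ∃ b : ℝ, b ≤ 0 ∧ (N : ENNReal) ≤ μ (Set.Ioc b 0) := by
  have h1 := tendsto_measure_iUnion_atTop (μ := μ) (s := fun k : ℕ => Set.Ioc (-k : ℝ) 0)
    (fun i j hij => Set.Ioc_subset_Ioc_left (by gcongr))
  have h2 : (⋃ k : ℕ, Set.Ioc (-k : ℝ) 0) = Set.Iic 0 := by
    ext x
    simp only [Set.mem_iUnion, Set.mem_Ioc, Set.mem_Iic]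
    refine ⟨fun ⟨k, hk⟩ => hk.2, fun hx => ?_⟩
    obtain ⟨k, hk⟩ := exists_nat_gt (-x)
    exact ⟨k, by linarith, hx⟩
  have h3 : μ (Set.Iic 0) = ⊤ := measure_mono_top Set.Iio_subset_Iic_self hμ
  rw [h2, h3] at h1
  obtain ⟨k, hk⟩ := (h1.eventually (lt_mem_nhds (ENNReal.natCast_lt_top N))).exists
  exact ⟨-k, by simp, le_of_lt hk⟩

theorem xLabel_le_iff {μ : Measure ℝ} (hμ : IsPointMeasure μ) (hinf : InfiniteBothDirections μ)
    {n : ℤ} (hn : 0 < n) (b : ℝ) :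
    xLabel μ n ≤ b ↔ (n.toNat : ENNReal) ≤ μ (Set.Ioc 0 b) := by
  rw [xLabel, if_pos hn]
  set S := {x : ℝ | 0 < x ∧ (n.toNat : ENNReal) ≤ μ (Set.Ioc 0 x)} with hS
  have hbdd : BddBelow S := ⟨0, fun x hx => hx.1.le⟩
  have hne : S.Nonempty := exists_le_measure_Ioc_right hinf.2 _
  constructor
  · intro h
    refine hμ.le_measure_Ioc_of_forall_gt fun r hr => ?_
    obtain ⟨y, hy, hyr⟩ := exists_lt_of_csInf_lt hne (h.trans_lt hr)
    exact hy.2.trans (measure_mono (Set.Ioc_subset_Ioc_right hyr.le))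
  · intro h
    refine csInf_le hbdd ⟨?_, h⟩
    by_contra! hb
    rw [Set.Ioc_eq_empty (not_lt.2 hb)] at h
    simp at h
    omega

theorem xLabel_pos {μ : Measure ℝ} (hμ : IsPointMeasure μ) (hinf : InfiniteBothDirections μ)
    {n : ℤ} (hn : 0 < n) : 0 < xLabel μ n := by
  by_contra! h
  rw [xLabel_le_iff hμ hinf hn] at h
  simp at h
  omega

theorem xLabel_nonpos {μ : Measure ℝ} {n : ℤ} (hn : n ≤ 0) : xLabel μ n ≤ 0 := by
  rw [xLabel, if_neg (not_lt.2 hn)]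
  exact Real.sSup_nonpos fun x hx => hx.1

theorem le_xLabel_iff {μ : Measure ℝ} (hμ : IsPointMeasure μ) (hinf : InfiniteBothDirections μ)
    {n : ℤ} (hn : n ≤ 0) (a : ℝ) :
    a ≤ xLabel μ n ↔ ((1 - n).toNat : ENNReal) ≤ μ (Set.Icc a 0) := by
  rw [xLabel, if_neg (not_lt.2 hn)]
  set S := {x : ℝ | x ≤ 0 ∧ ((1 - n).toNat : ENNReal) ≤ μ (Set.Ioc x 0)} with hS
  have hbdd : BddAbove S := ⟨0, fun x hx => hx.1⟩
  have hne : S.Nonempty := exists_le_measure_Ioc_left hinf.1 _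
  constructor
  · intro h
    refine hμ.le_measure_Icc_of_forall_lt fun r hr => ?_
    obtain ⟨y, hy, hyr⟩ := exists_lt_of_lt_csSup hne (hr.trans_le h)
    exact hy.2.trans (measure_mono (Set.Ioc_subset_Ioc_left hyr.le))
  · intro h
    have ha : a ≤ 0 := by
      by_contra! hb
      rw [Set.Icc_eq_empty (not_le.2 hb)] at h
      simp at h
      omega
    refine le_of_forall_lt fun x hx => ?_
    obtain ⟨y, hxy, hya⟩ := exists_between hx
    refine hxy.trans_le (le_csSup hbdd ⟨by linarith, h.trans (measure_mono fun z hz => ?_)⟩)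
    exact ⟨hya.trans_le hz.1, hz.2⟩

theorem sum_dirac_apply_eq_encard {ι : Type*} (x : ι → ℝ) {B : Set ℝ} (hB : MeasurableSet B) :
    Measure.sum (fun n => Measure.dirac (x n)) B = ({n | x n ∈ B}.encard : ENNReal) := by
  rw [Measure.sum_apply _ hB, ← ENNReal.tsum_set_one, tsum_subtype {n | x n ∈ B} fun _ => 1]
  refine tsum_congr fun n => ?_
  rw [Measure.dirac_apply' _ hB]
  rfl

theorem sum_dirac_xLabel_Ioc {μ : Measure ℝ} (hμ : IsPointMeasure μ)
    (hinf : InfiniteBothDirections μ) (b : ℝ) :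
    Measure.sum (fun n => Measure.dirac (xLabel μ n)) (Set.Ioc 0 b) = μ (Set.Ioc 0 b) := by
  obtain ⟨m, hm⟩ := hμ (Set.Ioc 0 b) measurableSet_Ioc (Metric.isBounded_Ioc _ _)
  have : {n | xLabel μ n ∈ Set.Ioc 0 b} = (Finset.Ioc (0 : ℤ) m : Set ℤ) := by
    ext n
    simp only [Set.mem_ofPred_eq, Finset.coe_Ioc]
    rcases lt_or_ge 0 n with hn | hn
    · have := xLabel_pos hμ hinf hn
      have h2 := xLabel_le_iff hμ hinf hn b
      rw [hm, Nat.cast_le] at h2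
      simp only [Set.mem_Ioc, this, h2, hn, true_and]
      omega
    · have := xLabel_nonpos (μ := μ) hn
      simp only [Set.mem_Ioc, not_lt.2 this, not_lt.2 hn, false_and]
  rw [sum_dirac_apply_eq_encard _ measurableSet_Ioc, this, Set.encard_coe_eq_coe_finsetCard, hm]
  simp

theorem sum_dirac_xLabel_Icc {μ : Measure ℝ} (hμ : IsPointMeasure μ)
    (hinf : InfiniteBothDirections μ) (a : ℝ) :
    Measure.sum (fun n => Measure.dirac (xLabel μ n)) (Set.Icc a 0) = μ (Set.Icc a 0) := by
  obtain ⟨m, hm⟩ := hμ (Set.Icc a 0) measurableSet_Icc (Metric.isBounded_Icc _ _)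
  have : {n | xLabel μ n ∈ Set.Icc a 0} = (Finset.Icc (1 - m : ℤ) 0 : Set ℤ) := by
    ext n
    simp only [Set.mem_ofPred_eq, Finset.coe_Icc]
    rcases lt_or_ge 0 n with hn | hn
    · have := xLabel_pos hμ hinf hn
      simp only [Set.mem_Icc, not_le.2 this, not_le.2 hn, and_false]
    · have := xLabel_nonpos (μ := μ) hn
      have h2 := le_xLabel_iff hμ hinf hn a
      rw [hm, Nat.cast_le] at h2
      simp only [Set.mem_Icc, this, h2, hn, and_true]
      omega
  rw [sum_dirac_apply_eq_encard _ measurableSet_Icc, this, Set.encard_coe_eq_coe_finsetCard, hm]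
  simp

theorem eq_sum_dirac_xLabel {μ : Measure ℝ} (hμ : IsPointMeasure μ)
    (hinf : InfiniteBothDirections μ) :
    μ = Measure.sum (fun n => Measure.dirac (xLabel μ n)) := by
  set ν := Measure.sum (fun n => Measure.dirac (xLabel μ n)) with hν
  have h1 : μ.restrict (Set.Ioi 0) = ν.restrict (Set.Ioi 0) := by
    have := hμ.isLocallyFiniteMeasure
    refine Measure.ext_of_Ioc _ _ fun a b hab => ?_
    rw [Measure.restrict_apply measurableSet_Ioc, Measure.restrict_apply measurableSet_Ioc]
    have : Set.Ioc a b ∩ Set.Ioi 0 = Set.Ioc 0 b \ Set.Ioc 0 a := by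
      ext x
      simp only [Set.mem_inter_iff, Set.mem_Ioc, Set.mem_Ioi, Set.mem_sdiff]
      grind
    rw [this]
    have hsub : Set.Ioc 0 a ⊆ Set.Ioc 0 b := Set.Ioc_subset_Ioc_right hab.le
    have hne := hμ.measure_ne_top (measurableSet_Ioc (a := 0) (b := a)) (Metric.isBounded_Ioc _ _)
    rw [measure_sdiff hsub measurableSet_Ioc.nullMeasurableSet hne,
      measure_sdiff hsub measurableSet_Ioc.nullMeasurableSet
        (by rwa [sum_dirac_xLabel_Ioc hμ hinf]), sum_dirac_xLabel_Ioc hμ hinf,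
        sum_dirac_xLabel_Ioc hμ hinf]
  have h2 : μ.restrict (Set.Ioi 0)ᶜ = ν.restrict (Set.Ioi 0)ᶜ := by
    have := hμ.isLocallyFiniteMeasure
    refine Measure.ext_of_Ico _ _ fun a b hab => ?_
    rw [Measure.restrict_apply measurableSet_Ico, Measure.restrict_apply measurableSet_Ico]
    have : Set.Ico a b ∩ (Set.Ioi 0)ᶜ = Set.Icc a 0 \ Set.Icc b 0 := by
      ext x
      simp only [Set.mem_inter_iff, Set.mem_Ico, Set.mem_Icc, Set.mem_Ioi, Set.mem_sdiff,
        Set.mem_compl_iff]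
      grind
    rw [this]
    have hsub : Set.Icc b 0 ⊆ Set.Icc a 0 := Set.Icc_subset_Icc_left hab.le
    have hne := hμ.measure_ne_top (measurableSet_Icc (a := b) (b := 0)) (Metric.isBounded_Icc _ _)
    rw [measure_sdiff hsub measurableSet_Icc.nullMeasurableSet hne,
      measure_sdiff hsub measurableSet_Icc.nullMeasurableSet
        (by rwa [sum_dirac_xLabel_Icc hμ hinf]), sum_dirac_xLabel_Icc hμ hinf,
        sum_dirac_xLabel_Icc hμ hinf]
  rw [← Measure.restrict_add_restrict_compl (μ := μ) (measurableSet_Ioi (a := 0)), h1, h2,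
    Measure.restrict_add_restrict_compl measurableSet_Ioi]

theorem encard_xLabel_mem {μ : Measure ℝ} (hμ : IsPointMeasure μ)
    (hinf : InfiniteBothDirections μ) {B : Set ℝ} (hB : MeasurableSet B) :
    ({n | xLabel μ n ∈ B}.encard : ENNReal) = μ B := by
  rw [← sum_dirac_apply_eq_encard _ hB, ← eq_sum_dirac_xLabel hμ hinf]

theorem finite_xLabel_mem {μ : Measure ℝ} (hμ : IsPointMeasure μ)
    (hinf : InfiniteBothDirections μ) (a b : ℝ) : {n | xLabel μ n ∈ Set.Icc a b}.Finite := by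
  have h := encard_xLabel_mem hμ hinf (measurableSet_Icc (a := a) (b := b))
  have h2 := hμ.measure_ne_top (measurableSet_Icc (a := a) (b := b)) (Metric.isBounded_Icc _ _)
  rw [← h] at h2
  rw [← Set.encard_lt_top_iff]
  exact lt_top_iff_ne_top.2 fun h3 => h2 (by rw [h3]; rfl)

theorem card_xLabel_mem {μ : Measure ℝ} (hμ : IsPointMeasure μ)
    (hinf : InfiniteBothDirections μ) (a b : ℝ) :
    ((finite_xLabel_mem hμ hinf a b).toFinset.card : ℝ) = (μ (Set.Icc a b)).toReal := by
  rw [← encard_xLabel_mem hμ hinf measurableSet_Icc,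
    (finite_xLabel_mem hμ hinf a b).encard_eq_coe_toFinset_card]
  simp

theorem integral_eq_tsum_xLabel {μ : Measure ℝ} (hμ : IsPointMeasure μ)
    (hinf : InfiniteBothDirections μ) {f : ℝ → ℝ} (hf : Continuous f) (hfc : HasCompactSupport f) :
    ∫ x, f x ∂μ = ∑' n, f (xLabel μ n) := by
  have := hμ.isLocallyFiniteMeasure
  have hi : Integrable f μ := hf.integrable_of_hasCompactSupport hfc
  rw [eq_sum_dirac_xLabel hμ hinf] at hi
  conv_lhs => rw [eq_sum_dirac_xLabel hμ hinf]
  rw [integral_sum_measure hi]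
  simp

open Classical in
/-- The summand of the correlation sum `corrSumM` at a tuple of indices. -/
noncomputable def corrTerm (μ : Measure ℝ) (k : ℕ) (f : (Fin k → ℝ) → ℝ) (m : Fin k → ℤ) : ℝ :=
  if Function.Injective m then f (fun i => xLabel μ (m i)) else 0

theorem corrSumM_eq_tsum (μ : Measure ℝ) (k : ℕ) (f : (Fin k → ℝ) → ℝ) :
    corrSumM μ k f = ∑' m, corrTerm μ k f m := rfl

theorem corrTerm_ne_zero {μ : Measure ℝ} {k : ℕ} {f : (Fin k → ℝ) → ℝ} {a b : ℝ}
    (hf : ∀ y, f y ≠ 0 → ∀ i, y i ∈ Set.Icc a b) {m : Fin k → ℤ} (h : corrTerm μ k f m ≠ 0) (i : Fin k) :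
    xLabel μ (m i) ∈ Set.Icc a b := by
  unfold corrTerm at h
  split_ifs at h
  · exact hf _ h i
  · exact absurd rfl h

theorem support_corrTerm_subset {μ : Measure ℝ} (hμ : IsPointMeasure μ)
    (hinf : InfiniteBothDirections μ) {k : ℕ} {f : (Fin k → ℝ) → ℝ} {a b : ℝ}
    (hf : ∀ y, f y ≠ 0 → ∀ i, y i ∈ Set.Icc a b) :
    Function.support (corrTerm μ k f) ⊆
      (Fintype.piFinset fun _ : Fin k => (finite_xLabel_mem hμ hinf a b).toFinset : Set (Fin k → ℤ)) := by
  intro m hm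
  simp only [Finset.mem_coe, Fintype.mem_piFinset, Set.Finite.mem_toFinset]
  exact fun i => corrTerm_ne_zero hf hm i

theorem summable_corrTerm {μ : Measure ℝ} (hμ : IsPointMeasure μ)
    (hinf : InfiniteBothDirections μ) {k : ℕ} {f : (Fin k → ℝ) → ℝ} {a b : ℝ}
    (hf : ∀ y, f y ≠ 0 → ∀ i, y i ∈ Set.Icc a b) : Summable (corrTerm μ k f) :=
  summable_of_hasFiniteSupport ((Finset.finite_toSet _).subset (support_corrTerm_subset hμ hinf hf))

theorem abs_corrSumM_le {μ : Measure ℝ} (hμ : IsPointMeasure μ)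
    (hinf : InfiniteBothDirections μ) {k : ℕ} {f : (Fin k → ℝ) → ℝ} {a b M : ℝ}
    (hf : ∀ y, f y ≠ 0 → ∀ i, y i ∈ Set.Icc a b) (hM : ∀ y, |f y| ≤ M) :
    |corrSumM μ k f| ≤ M * (μ (Set.Icc a b)).toReal ^ k := by
  have hM0 : 0 ≤ M := (abs_nonneg _).trans (hM 0)
  rw [corrSumM_eq_tsum, tsum_eq_sum' (support_corrTerm_subset hμ hinf hf)]
  refine (Finset.abs_sum_le_sum_abs _ _).trans ((Finset.sum_le_card_nsmul _ _ M fun m _ => ?_).trans ?_)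
  · unfold corrTerm
    split_ifs
    · exact hM _
    · simpa using hM0
  · rw [Fintype.card_piFinset_const, nsmul_eq_mul, Nat.cast_pow, card_xLabel_mem hμ hinf, mul_comm]

theorem corrSumM_one {μ : Measure ℝ} (hμ : IsPointMeasure μ)
    (hinf : InfiniteBothDirections μ) {f : ℝ → ℝ} (hf : Continuous f) (hfc : HasCompactSupport f) :
    corrSumM μ 1 (fun y => f (y 0)) = ∫ x, f x ∂μ := by
  rw [integral_eq_tsum_xLabel hμ hinf hf hfc, corrSumM_eq_tsum,
    ← (Equiv.funUnique (Fin 1) ℤ).tsum_eq]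
  refine tsum_congr fun m => ?_
  rw [corrTerm, if_pos (Function.injective_of_subsingleton m)]
  rfl

theorem mul_corrTerm_eq (μ : Measure ℝ) (k : ℕ) (F : (Fin k → ℝ) → ℝ) (f : ℝ → ℝ) (n : ℤ)
    (m : Fin k → ℤ) :
    f (xLabel μ n) * corrTerm μ k F m =
      corrTerm μ (k + 1) (fun y => f (y (Fin.last k)) * F (fun i => y i.castSucc))
        (Fin.snoc (α := fun _ => ℤ) m n) +
      ∑ i, if n = m i then corrTerm μ k (fun y => f (y i) * F y) m else 0 := by
  simp only [corrTerm, Fin.snoc_injective_iff, Fin.snoc_last, Fin.snoc_castSucc]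
  by_cases hm : Function.Injective m
  · by_cases hn : n ∈ Set.range m
    · obtain ⟨i, rfl⟩ := hn
      rw [Finset.sum_eq_single i (fun j _ hj => if_neg fun h => hj (hm h).symm) (by simp)]
      simp [hm]
    · have : ∀ i, n ≠ m i := fun i h => hn ⟨i, h.symm⟩
      simp [hm, hn, this]
  · simp [hm]

theorem integral_mul_corrSumM {μ : Measure ℝ} (hμ : IsPointMeasure μ)
    (hinf : InfiniteBothDirections μ) {k : ℕ} {F : (Fin k → ℝ) → ℝ} {f : ℝ → ℝ} {a b : ℝ}
    (hF : ∀ y, F y ≠ 0 → ∀ i, y i ∈ Set.Icc a b) (hfs : ∀ x, f x ≠ 0 → x ∈ Set.Icc a b)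
    (hf : Continuous f) (hfc : HasCompactSupport f) :
    (∫ x, f x ∂μ) * corrSumM μ k F =
      corrSumM μ (k + 1) (fun y => f (y (Fin.last k)) * F (fun i => y i.castSucc)) +
      ∑ i, corrSumM μ k (fun y => f (y i) * F y) := by
  have hsf : Summable fun n => f (xLabel μ n) :=
    summable_of_hasFiniteSupport ((finite_xLabel_mem hμ hinf a b).subset fun n hn => hfs _ hn)
  have hsF := summable_corrTerm hμ hinf hF
  have hG : ∀ y : Fin (k + 1) → ℝ, f (y (Fin.last k)) * F (fun i => y i.castSucc) ≠ 0 →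
      ∀ i, y i ∈ Set.Icc a b := by
    intro y hy i
    refine Fin.lastCases ?_ (fun j => ?_) i
    · exact hfs _ (left_ne_zero_of_mul hy)
    · exact hF _ (right_ne_zero_of_mul hy) j
  have hH : ∀ i, ∀ y : Fin k → ℝ, f (y i) * F y ≠ 0 → ∀ j, y j ∈ Set.Icc a b :=
    fun i y hy => hF _ (right_ne_zero_of_mul hy)
  let e : ℤ × (Fin k → ℤ) ≃ (Fin (k + 1) → ℤ) := Fin.snocEquiv fun _ => ℤ
  have hsG : Summable fun p : ℤ × (Fin k → ℤ) =>
      corrTerm μ (k + 1) (fun y => f (y (Fin.last k)) * F (fun i => y i.castSucc))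
        (Fin.snoc (α := fun _ => ℤ) p.2 p.1) :=
    (summable_corrTerm hμ hinf hG).comp_injective e.injective
  have hinj : ∀ i : Fin k, Function.Injective fun m : Fin k → ℤ => (m i, m) :=
    fun i m m' h => (Prod.ext_iff.1 h).2
  have hsupp : ∀ i : Fin k, Function.support (fun p : ℤ × (Fin k → ℤ) =>
      if p.1 = p.2 i then corrTerm μ k (fun y => f (y i) * F y) p.2 else 0) ⊆
      Set.range fun m : Fin k → ℤ => (m i, m) := by
    rintro i ⟨n, m⟩ h
    simp only [Function.mem_support] at h
    split_ifs at h with h1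
    · exact ⟨m, by simp [h1]⟩
    · exact absurd rfl h
  have hsH : ∀ i : Fin k, Summable (fun p : ℤ × (Fin k → ℤ) =>
      if p.1 = p.2 i then corrTerm μ k (fun y => f (y i) * F y) p.2 else 0) := by
    intro i
    rw [← (hinj i).summable_iff (fun x hx => by
      by_contra h
      exact hx (hsupp i h))]
    simpa [Function.comp_def] using! summable_corrTerm hμ hinf (hH i)
  rw [integral_eq_tsum_xLabel hμ hinf hf hfc, corrSumM_eq_tsum,
    tsum_mul_tsum_of_summable_norm hsf.norm hsF.norm]
  simp_rw [mul_corrTerm_eq]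
  rw [Summable.tsum_add hsG
    (summable_sum fun i _ => hsH i), Summable.tsum_finsetSum fun i _ => hsH i]
  congr 1
  · exact e.tsum_eq (corrTerm μ (k + 1) fun y => f (y (Fin.last k)) * F (fun i => y i.castSucc))
  · refine Finset.sum_congr rfl fun i _ => ?_
    rw [← (hinj i).tsum_eq (hsupp i), corrSumM_eq_tsum]
    simp

theorem HasCompactSupport.exists_Icc_of_ne_zero {k : ℕ} {F : (Fin k → ℝ) → ℝ}
    (hF : HasCompactSupport F) : ∃ R : ℝ, ∀ y, F y ≠ 0 → ∀ i, y i ∈ Set.Icc (-R) R := by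
  obtain ⟨R, hR⟩ := hF.isCompact.isBounded.exists_norm_le
  exact ⟨R, fun y hy i => abs_le.1 ((norm_le_pi_norm y i).trans (hR y (subset_tsupport _ hy)))⟩

theorem hasCompactSupport_of_ne_zero {k : ℕ} {F : (Fin k → ℝ) → ℝ} {a b : ℝ}
    (hF : ∀ y, F y ≠ 0 → ∀ i, y i ∈ Set.Icc a b) : HasCompactSupport F := by
  refine HasCompactSupport.intro (isCompact_univ_pi fun _ : Fin k => isCompact_Icc (a := a) (b := b))
    fun y hy => ?_
  by_contra h
  exact hy fun i _ => hF y h i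

section PointProcess

variable {Ω : Type*} [MeasurableSpace Ω] {P : Measure Ω} {ξ : Ω → Measure ℝ}

theorem aemeasurable_xLabel (hmeas : Measurable ξ)
    (hpp : ∀ᵐ ω ∂P, IsPointMeasure (ξ ω) ∧ InfiniteBothDirections (ξ ω)) (n : ℤ) :
    AEMeasurable (fun ω => xLabel (ξ ω) n) P := by
  refine NullMeasurable.aemeasurable ?_
  rcases lt_or_ge 0 n with hn | hn
  · refine measurable_of_Iic (δ := NullMeasurableSpace Ω P) fun b => ?_
    have h1 : MeasurableSet {ω | (n.toNat : ENNReal) ≤ ξ ω (Set.Ioc 0 b)} :=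
      measurableSet_le measurable_const (Measure.measurable_coe measurableSet_Ioc |>.comp hmeas)
    refine NullMeasurableSet.congr h1.nullMeasurableSet ?_
    filter_upwards [hpp] with ω hω
    exact propext (xLabel_le_iff hω.1 hω.2 hn b).symm
  · refine measurable_of_Ici (δ := NullMeasurableSpace Ω P) fun a => ?_
    have h1 : MeasurableSet {ω | ((1 - n).toNat : ENNReal) ≤ ξ ω (Set.Icc a 0)} :=
      measurableSet_le measurable_const (Measure.measurable_coe measurableSet_Icc |>.comp hmeas)
    refine NullMeasurableSet.congr h1.nullMeasurableSet ?_
    filter_upwards [hpp] with ω hω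
    exact propext (le_xLabel_iff hω.1 hω.2 hn a).symm

theorem aemeasurable_corrSumM (hmeas : Measurable ξ)
    (hpp : ∀ᵐ ω ∂P, IsPointMeasure (ξ ω) ∧ InfiniteBothDirections (ξ ω)) {k : ℕ}
    {F : (Fin k → ℝ) → ℝ} (hF : Continuous F) (hFc : HasCompactSupport F) :
    AEMeasurable (fun ω => corrSumM (ξ ω) k F) P := by
  obtain ⟨R, hR⟩ := hFc.exists_Icc_of_ne_zero
  refine aemeasurable_of_tendsto_metrizable_ae (atTop : Filter (Finset (Fin k → ℤ)))
    (f := fun s ω => ∑ m ∈ s, corrTerm (ξ ω) k F m) (fun s => ?_) ?_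
  · refine Finset.aemeasurable_fun_sum _ fun m _ => ?_
    unfold corrTerm
    split_ifs
    · exact hF.measurable.comp_aemeasurable
        (aemeasurable_pi_lambda _ fun i => aemeasurable_xLabel hmeas hpp (m i))
    · exact aemeasurable_const
  · filter_upwards [hpp] with ω hω
    exact (summable_corrTerm hω.1 hω.2 hR).hasSum

theorem aemeasurable_integral (hmeas : Measurable ξ)
    (hpp : ∀ᵐ ω ∂P, IsPointMeasure (ξ ω) ∧ InfiniteBothDirections (ξ ω)) {f : ℝ → ℝ}
    (hf : Continuous f) (hfc : HasCompactSupport f) :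
    AEMeasurable (fun ω => ∫ x, f x ∂(ξ ω)) P := by
  have hc : HasCompactSupport fun y : Fin 1 → ℝ => f (y 0) :=
    hfc.comp_homeomorph (Homeomorph.funUnique (Fin 1) ℝ)
  refine (aemeasurable_corrSumM hmeas hpp (by fun_prop) hc).congr ?_
  filter_upwards [hpp] with ω hω
  exact corrSumM_one hω.1 hω.2 hf hfc

theorem abs_integral_le {μ : Measure ℝ} (hμ : IsPointMeasure μ)
    (hinf : InfiniteBothDirections μ) {f : ℝ → ℝ} (hf : Continuous f) (hfc : HasCompactSupport f)
    {a b M : ℝ} (hfs : ∀ x, f x ≠ 0 → x ∈ Set.Icc a b) (hM : ∀ x, |f x| ≤ M) :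
    |∫ x, f x ∂μ| ≤ M * (μ (Set.Icc a b)).toReal := by
  have := abs_corrSumM_le hμ hinf (f := fun y : Fin 1 → ℝ => f (y 0)) (a := a) (b := b) (M := M)
    (fun y hy i => by rw [Subsingleton.elim i 0]; exact hfs _ hy) (fun y => hM _)
  rwa [corrSumM_one hμ hinf hf hfc, pow_one] at this

theorem integrable_corrSumM_mul_pow (hmeas : Measurable ξ)
    (hpp : ∀ᵐ ω ∂P, IsPointMeasure (ξ ω) ∧ InfiniteBothDirections (ξ ω))
    (hmom : ∀ (k : ℕ) (a b : ℝ), Integrable (fun ω => (ξ ω (Set.Icc a b)).toReal ^ k) P) {k : ℕ}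
    {F : (Fin k → ℝ) → ℝ} (hF : Continuous F) (hFc : HasCompactSupport F) {f : ℝ → ℝ}
    (hf : Continuous f) (hfc : HasCompactSupport f) {a b : ℝ}
    (hFs : ∀ y, F y ≠ 0 → ∀ i, y i ∈ Set.Icc a b) (hfs : ∀ x, f x ≠ 0 → x ∈ Set.Icc a b) (j : ℕ) :
    Integrable (fun ω => corrSumM (ξ ω) k F * (∫ x, f x ∂(ξ ω)) ^ j) P := by
  obtain ⟨M, hM⟩ := hFc.exists_bound_of_continuous hF
  obtain ⟨M', hM'⟩ := hfc.exists_bound_of_continuous hf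
  refine ((hmom (k + j) a b).const_mul (M * M' ^ j)).mono'
    ((aemeasurable_corrSumM hmeas hpp hF hFc).mul
      ((aemeasurable_integral hmeas hpp hf hfc).pow_const j)).aestronglyMeasurable ?_
  filter_upwards [hpp] with ω hω
  have h1 := abs_corrSumM_le hω.1 hω.2 hFs hM
  have h2 := abs_integral_le hω.1 hω.2 hf hfc hfs hM'
  have h0 := (abs_nonneg _).trans h1
  rw [norm_mul, norm_pow, Real.norm_eq_abs, Real.norm_eq_abs]
  calc _ ≤ (M * (ξ ω (Set.Icc a b)).toReal ^ k) * (M' * (ξ ω (Set.Icc a b)).toReal) ^ j := by gcongr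
    _ = _ := by ring

theorem integrable_integral_pow [IsProbabilityMeasure P] (hmeas : Measurable ξ)
    (hpp : ∀ᵐ ω ∂P, IsPointMeasure (ξ ω) ∧ InfiniteBothDirections (ξ ω))
    (hmom : ∀ (k : ℕ) (a b : ℝ), Integrable (fun ω => (ξ ω (Set.Icc a b)).toReal ^ k) P)
    {f : ℝ → ℝ} (hf : Continuous f) (hfc : HasCompactSupport f) {a b : ℝ}
    (hfs : ∀ x, f x ≠ 0 → x ∈ Set.Icc a b) (j : ℕ) :
    Integrable (fun ω => (∫ x, f x ∂(ξ ω)) ^ j) P := by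
  obtain ⟨M', hM'⟩ := hfc.exists_bound_of_continuous hf
  refine ((hmom j a b).const_mul (M' ^ j)).mono'
    ((aemeasurable_integral hmeas hpp hf hfc).pow_const j).aestronglyMeasurable ?_
  filter_upwards [hpp] with ω hω
  have h2 := abs_integral_le hω.1 hω.2 hf hfc hfs hM'
  rw [norm_pow, Real.norm_eq_abs, ← mul_pow]
  gcongr

theorem integral_corrSumM_mul_pow_succ (hmeas : Measurable ξ)
    (hpp : ∀ᵐ ω ∂P, IsPointMeasure (ξ ω) ∧ InfiniteBothDirections (ξ ω))
    (hmom : ∀ (k : ℕ) (a b : ℝ), Integrable (fun ω => (ξ ω (Set.Icc a b)).toReal ^ k) P) {k : ℕ}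
    {F : (Fin k → ℝ) → ℝ} (hF : Continuous F) {f : ℝ → ℝ}
    (hf : Continuous f) (hfc : HasCompactSupport f) {a b : ℝ}
    (hFs : ∀ y, F y ≠ 0 → ∀ i, y i ∈ Set.Icc a b) (hfs : ∀ x, f x ≠ 0 → x ∈ Set.Icc a b)
    (hG : ∀ y : Fin (k + 1) → ℝ, f (y (Fin.last k)) * F (fun i => y i.castSucc) ≠ 0 →
      ∀ i, y i ∈ Set.Icc a b)
    (hH : ∀ i, ∀ y : Fin k → ℝ, f (y i) * F y ≠ 0 → ∀ j, y j ∈ Set.Icc a b) (j : ℕ) :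
    ∫ ω, corrSumM (ξ ω) k F * (∫ x, f x ∂(ξ ω)) ^ (j + 1) ∂P =
      (∫ ω, corrSumM (ξ ω) (k + 1) (fun y => f (y (Fin.last k)) * F (fun i => y i.castSucc)) *
        (∫ x, f x ∂(ξ ω)) ^ j ∂P) +
      ∑ i, ∫ ω, corrSumM (ξ ω) k (fun y => f (y i) * F y) * (∫ x, f x ∂(ξ ω)) ^ j ∂P := by
  have hi1 := integrable_corrSumM_mul_pow hmeas hpp hmom (by fun_prop)
    (hasCompactSupport_of_ne_zero hG) hf hfc hG hfs j
  have hi2 := fun i => integrable_corrSumM_mul_pow hmeas hpp hmom (by fun_prop)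
    (hasCompactSupport_of_ne_zero (hH i)) hf hfc (hH i) hfs j
  rw [← integral_finsetSum _ fun i _ => hi2 i,
    ← integral_add hi1 (integrable_finsetSum _ fun i _ => hi2 i)]
  refine integral_congr_ae ?_
  filter_upwards [hpp] with ω hω
  rw [← Finset.sum_mul, ← add_mul, ← integral_mul_corrSumM hω.1 hω.2 hFs hfs hf hfc]
  ring

theorem tendsto_integral_corrSumM_mul_pow {ξs : ℕ → Ω → Measure ℝ}
    (hmeas : Measurable ξ) (hmeass : ∀ ℓ, Measurable (ξs ℓ))
    (hpp : ∀ᵐ ω ∂P, IsPointMeasure (ξ ω) ∧ InfiniteBothDirections (ξ ω))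
    (hpps : ∀ ℓ, ∀ᵐ ω ∂P, IsPointMeasure (ξs ℓ ω) ∧ InfiniteBothDirections (ξs ℓ ω))
    (hmom : ∀ (k : ℕ) (a b : ℝ), Integrable (fun ω => (ξ ω (Set.Icc a b)).toReal ^ k) P)
    (hmoms : ∀ (ℓ k : ℕ) (a b : ℝ), Integrable (fun ω => (ξs ℓ ω (Set.Icc a b)).toReal ^ k) P)
    (hcorr : ConvInCorr P ξs ξ) {f : ℝ → ℝ} (hf : Continuous f) (hfc : HasCompactSupport f)
    {a b : ℝ} (hfs : ∀ x, f x ≠ 0 → x ∈ Set.Icc a b) (j : ℕ) :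
    ∀ k : ℕ, 1 ≤ k → ∀ F : (Fin k → ℝ) → ℝ, Continuous F →
      (∀ y, F y ≠ 0 → ∀ i, y i ∈ Set.Icc a b) →
      Tendsto (fun ℓ => ∫ ω, corrSumM (ξs ℓ ω) k F * (∫ x, f x ∂(ξs ℓ ω)) ^ j ∂P) atTop
        (𝓝 (∫ ω, corrSumM (ξ ω) k F * (∫ x, f x ∂(ξ ω)) ^ j ∂P)) := by
  induction j with
  | zero =>
    intro k hk F hF hFs
    simpa using hcorr k hk F hF (hasCompactSupport_of_ne_zero hFs)
  | succ j ih =>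
    intro k hk F hF hFs
    have hG : ∀ y : Fin (k + 1) → ℝ, f (y (Fin.last k)) * F (fun i => y i.castSucc) ≠ 0 →
        ∀ i, y i ∈ Set.Icc a b := by
      intro y hy i
      refine Fin.lastCases ?_ (fun j => ?_) i
      · exact hfs _ (left_ne_zero_of_mul hy)
      · exact hFs _ (right_ne_zero_of_mul hy) j
    have hH : ∀ i, ∀ y : Fin k → ℝ, f (y i) * F y ≠ 0 → ∀ j, y j ∈ Set.Icc a b :=
      fun i y hy => hFs _ (right_ne_zero_of_mul hy)
    rw [integral_corrSumM_mul_pow_succ hmeas hpp hmom hF hf hfc hFs hfs hG hH]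
    simp_rw [fun ℓ => integral_corrSumM_mul_pow_succ (hmeass ℓ) (hpps ℓ) (hmoms ℓ) hF hf hfc hFs hfs
      hG hH j]
    exact (ih (k + 1) (by omega) _ (by fun_prop) hG).add
      (tendsto_finsetSum _ fun i _ => ih k hk _ (by fun_prop) (hH i))

theorem tendsto_integral_pow [IsProbabilityMeasure P] {ξs : ℕ → Ω → Measure ℝ}
    (hmeas : Measurable ξ) (hmeass : ∀ ℓ, Measurable (ξs ℓ))
    (hpp : ∀ᵐ ω ∂P, IsPointMeasure (ξ ω) ∧ InfiniteBothDirections (ξ ω))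
    (hpps : ∀ ℓ, ∀ᵐ ω ∂P, IsPointMeasure (ξs ℓ ω) ∧ InfiniteBothDirections (ξs ℓ ω))
    (hmom : ∀ (k : ℕ) (a b : ℝ), Integrable (fun ω => (ξ ω (Set.Icc a b)).toReal ^ k) P)
    (hmoms : ∀ (ℓ k : ℕ) (a b : ℝ), Integrable (fun ω => (ξs ℓ ω (Set.Icc a b)).toReal ^ k) P)
    (hcorr : ConvInCorr P ξs ξ) {f : ℝ → ℝ} (hf : Continuous f) (hfc : HasCompactSupport f)
    {a b : ℝ} (hfs : ∀ x, f x ≠ 0 → x ∈ Set.Icc a b) (j : ℕ) :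
    Tendsto (fun ℓ => ∫ ω, (∫ x, f x ∂(ξs ℓ ω)) ^ j ∂P) atTop
      (𝓝 (∫ ω, (∫ x, f x ∂(ξ ω)) ^ j ∂P)) := by
  cases j with
  | zero => simp
  | succ j =>
    have h := tendsto_integral_corrSumM_mul_pow hmeas hmeass hpp hpps hmom hmoms hcorr hf hfc hfs j 1
      le_rfl (fun y => f (y 0)) (by fun_prop)
      (fun y hy i => by rw [Subsingleton.elim i 0]; exact hfs _ hy)
    have hpow : ∀ ζ : Ω → Measure ℝ,
        (∀ᵐ ω ∂P, IsPointMeasure (ζ ω) ∧ InfiniteBothDirections (ζ ω)) →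
        ∫ ω, corrSumM (ζ ω) 1 (fun y => f (y 0)) * (∫ x, f x ∂(ζ ω)) ^ j ∂P =
          ∫ ω, (∫ x, f x ∂(ζ ω)) ^ (j + 1) ∂P := fun ζ hζ => by
      refine integral_congr_ae ?_
      filter_upwards [hζ] with ω hω
      rw [corrSumM_one hω.1 hω.2 hf hfc, pow_succ']
    rw [hpow ξ hpp] at h
    simpa only [fun ℓ => hpow (ξs ℓ) (hpps ℓ)] using h

theorem integrable_toReal_pow_of_lintegral_lt_top (hmeas : Measurable ξ) {a b : ℝ} {k : ℕ}
    (h : ∫⁻ ω, (ξ ω (Set.Icc a b)) ^ k ∂P < ⊤) :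
    Integrable (fun ω => (ξ ω (Set.Icc a b)).toReal ^ k) P := by
  simp_rw [← ENNReal.toReal_pow]
  exact integrable_toReal_of_lintegral_ne_top
    ((Measure.measurable_coe measurableSet_Icc |>.comp hmeas).pow_const k).aemeasurable h.ne

theorem integrable_exp_of_tail [IsProbabilityMeasure P] (hmeas : Measurable ξ)
    (hpp : ∀ᵐ ω ∂P, IsPointMeasure (ξ ω) ∧ InfiniteBothDirections (ξ ω)) {a b C c : ℝ}
    (hc : 0 < c) (htail : ∀ t : ℝ, 0 ≤ t →
      (P {ω | ENNReal.ofReal t ≤ ξ ω (Set.Icc a b)}).toReal ≤ C * Real.exp (-c * t)) :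
    Integrable (fun ω => Real.exp (c / 2 * (ξ ω (Set.Icc a b)).toReal)) P := by
  have hm : Measurable fun ω => ξ ω (Set.Icc a b) :=
    Measure.measurable_coe measurableSet_Icc |>.comp hmeas
  refine ⟨(hm.ennreal_toReal.const_mul _).exp.aestronglyMeasurable, ?_⟩
  rw [hasFiniteIntegral_iff_ofReal (ae_of_all _ fun ω => (Real.exp_pos _).le)]
  have hset : ∀ n : ℕ, MeasurableSet {ω | (n : ENNReal) ≤ ξ ω (Set.Icc a b)} := fun n =>
    measurableSet_le measurable_const hm
  calc ∫⁻ ω, ENNReal.ofReal (Real.exp (c / 2 * (ξ ω (Set.Icc a b)).toReal)) ∂P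
      ≤ ∫⁻ ω, ∑' n : ℕ, {ω | (n : ENNReal) ≤ ξ ω (Set.Icc a b)}.indicator
          (fun _ => ENNReal.ofReal (Real.exp (c / 2 * n))) ω ∂P := by
        refine lintegral_mono_ae ?_
        filter_upwards [hpp] with ω hω
        obtain ⟨m, hm⟩ := hω.1 (Set.Icc a b) measurableSet_Icc (Metric.isBounded_Icc _ _)
        refine le_trans ?_ (ENNReal.le_tsum m)
        rw [Set.indicator_of_mem (by simp [hm])]
        simp [hm]
    _ = ∑' n : ℕ, ENNReal.ofReal (Real.exp (c / 2 * n)) *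
          P {ω | (n : ENNReal) ≤ ξ ω (Set.Icc a b)} := by
        rw [lintegral_tsum fun n => (measurable_const.indicator (hset n)).aemeasurable]
        simp_rw [lintegral_indicator_const (hset _)]
    _ ≤ ∑' n : ℕ, ENNReal.ofReal (C * Real.exp (-(c / 2)) ^ n) := by
        refine ENNReal.tsum_le_tsum fun n => ?_
        have h1 := htail n (by positivity)
        rw [ENNReal.ofReal_natCast] at h1
        rw [← ENNReal.ofReal_toReal (measure_ne_top P {ω | (n : ENNReal) ≤ ξ ω (Set.Icc a b)}),
          ← ENNReal.ofReal_mul (Real.exp_pos _).le]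
        refine ENNReal.ofReal_le_ofReal ((mul_le_mul_of_nonneg_left h1 (Real.exp_pos _).le).trans_eq ?_)
        rw [← Real.exp_nat_mul, mul_left_comm, ← Real.exp_add]
        ring_nf
    _ < ⊤ := by
        refine Summable.tsum_ofReal_lt_top (Summable.mul_left _ (summable_geometric_of_lt_one
          (Real.exp_pos _).le ?_))
        rw [Real.exp_lt_one_iff]
        linarith

end PointProcess

/-- (Thm. `tail_bound_correlations`.) If the limiting point process has exponential tail
bounds for counts in compact intervals and the `ξ_ℓ` have all moments finite, then
convergence in correlation implies convergence in distribution. -/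
theorem stmt_5 {Ω : Type*} [MeasurableSpace Ω] (P : MeasureTheory.Measure Ω)
    [IsProbabilityMeasure P]
    (ξ : Ω → MeasureTheory.Measure ℝ) (ξs : ℕ → Ω → MeasureTheory.Measure ℝ)
    (hmeas : Measurable ξ) (hmeass : ∀ ℓ, Measurable (ξs ℓ))
    (hpp : ∀ᵐ ω ∂P, IsPointMeasure (ξ ω) ∧ InfiniteBothDirections (ξ ω))
    (hpps : ∀ ℓ, ∀ᵐ ω ∂P, IsPointMeasure (ξs ℓ ω) ∧ InfiniteBothDirections (ξs ℓ ω))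
    (htail : ∀ a b : ℝ, ∃ C c : ℝ, 0 < C ∧ 0 < c ∧ ∀ t : ℝ, 0 ≤ t →
      (P {ω | ENNReal.ofReal t ≤ ξ ω (Set.Icc a b)}).toReal ≤ C * Real.exp (-c * t))
    (hmoms : ∀ ℓ, ∀ k : ℕ, 1 ≤ k → ∀ a b : ℝ, ∫⁻ ω, (ξs ℓ ω (Set.Icc a b)) ^ k ∂P < ⊤)
    (hcorr : ConvInCorr P ξs ξ) :
    ConvInDist P ξs ξ := by
  intro f hf hfc g
  have hmom : ∀ (k : ℕ) (a b : ℝ), Integrable (fun ω => (ξ ω (Set.Icc a b)).toReal ^ k) P := by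
    intro k a b
    obtain ⟨C, c, -, hc, ht⟩ := htail a b
    have hm : Measurable fun ω => ξ ω (Set.Icc a b) :=
      Measure.measurable_coe measurableSet_Icc |>.comp hmeas
    have hexp := integrable_exp_of_tail hmeas hpp hc ht
    have := integrable_abs_pow_mul_exp (Y := fun ω => (ξ ω (Set.Icc a b)).toReal)
      hm.ennreal_toReal.aemeasurable (half_pos hc) (by simpa using hexp) k (h := 0) (by positivity)
    simpa using this
  have hmoms' : ∀ (ℓ k : ℕ) (a b : ℝ),
      Integrable (fun ω => (ξs ℓ ω (Set.Icc a b)).toReal ^ k) P := by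
    intro ℓ k a b
    rcases Nat.eq_zero_or_pos k with rfl | hk
    · simp
    · exact integrable_toReal_pow_of_lintegral_lt_top (hmeass ℓ) (hmoms ℓ k hk a b)
  obtain ⟨R, hR⟩ := hfc.isCompact.isBounded.exists_norm_le
  have hfs : ∀ x, f x ≠ 0 → x ∈ Set.Icc (-R) R := fun x hx => abs_le.1 (hR x (subset_tsupport _ hx))
  obtain ⟨M, hM⟩ := hfc.exists_bound_of_continuous hf
  have hM0 : 0 ≤ M := (norm_nonneg _).trans (hM 0)
  obtain ⟨C, c, -, hc, ht⟩ := htail (-R) R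
  have hY := aemeasurable_integral hmeas hpp hf hfc
  refine tendsto_integral_boundedContinuous_of_tendsto_moments (s := c / 2 / (M + 1))
    (fun ℓ => aemeasurable_integral (hmeass ℓ) (hpps ℓ) hf hfc) hY
    (fun ℓ k => integrable_integral_pow (hmeass ℓ) (hpps ℓ) (hmoms' ℓ) hf hfc hfs k)
    (by positivity) ?_
    (tendsto_integral_pow hmeas hmeass hpp hpps hmom hmoms' hcorr hf hfc hfs) g
  refine (integrable_exp_of_tail hmeas hpp hc ht).mono'
    ((continuous_abs.measurable.comp_aemeasurable hY).const_mul _).exp.aestronglyMeasurable ?_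
  filter_upwards [hpp] with ω hω
  have h1 := abs_integral_le hω.1 hω.2 hf hfc hfs hM
  have h2 : M * (ξ ω (Set.Icc (-R) R)).toReal ≤ (M + 1) * (ξ ω (Set.Icc (-R) R)).toReal := by
    gcongr
    linarith
  rw [Real.norm_of_nonneg (Real.exp_pos _).le, Real.exp_le_exp, div_mul_eq_mul_div,
    div_le_iff₀ (by positivity), mul_assoc, mul_comm _ (M + 1)]
  exact mul_le_mul_of_nonneg_left (h1.trans h2) (half_pos hc).le
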